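/- Let G be an additive commutative group, σ₁, σ₂ ∈ G, S = (σ₁, σ₂), and 𝒢 ⊆ G a subset with σ₁, σ₂ ∈ 𝒢. Let N* ∈ ℕ with N* ≥ 2 and suppose 𝒢 ∩ 𝒢_S^{(2N*+1)} ⊆ {σ₁, σ₂, 3·σ₁ − 2·σ₂}. Let N ∈ ℕ with 1 ≤ N and 3N ≤ 2N*, and assume the elements j·σ₁ + (1−j)·σ₂ for j = −⌊3N/2⌋, …, ⌊3(N+1)/2⌋ are pairwise distinct. Then S is weakly closed of order 2N+1 with respect to 𝒢, with witnessing chain 𝒢_{2n+1} := { j·σ₁ + (1−j)·σ₂ : −β_n ≤ j ≤ α_n } for n = 0,…,N, where α_n := ⌊3(n+1)/2⌋ and β_n := ⌊3n/2⌋. -/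

import Mathlib

/-- The set `𝒢_S^{(Λ)}` of all alternating-sign sums `Σ_{λ=1}^Λ (-1)^{λ+1} σ_{m_λ}` of elements
picked from the finite list `S : Fin M → G`. -/
def modeCombinations {G : Type*} [AddCommGroup G] {M : ℕ} (S : Fin M → G) (Λ : ℕ) : Set G :=
  {g | ∃ f : Fin Λ → Fin M, g = ∑ lam : Fin Λ, ((-1 : ℤ) ^ (lam : ℕ)) • S (f lam)}

/-- The associated sets `Ǧ_{2n+1}` of a chain `n ↦ 𝒢_{2n+1}`:
`Ǧ_{2n+1} = ⋃_{n₁+n₂+n₃ = n-1} (𝒢_{2n₁+1} - 𝒢_{2n₂+1} + 𝒢_{2n₃+1})` (for `n ≥ 1`). -/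
def checkSet {G : Type*} [AddCommGroup G] (Gc : ℕ → Set G) (n : ℕ) : Set G :=
  {g | ∃ n₁ n₂ n₃ : ℕ, n₁ + n₂ + n₃ = n - 1 ∧
    ∃ a ∈ Gc n₁, ∃ b ∈ Gc n₂, ∃ c ∈ Gc n₃, g = a - b + c}

/-- `Gc` (with `Gc n` playing the role of `𝒢_{2n+1}`) is a witnessing chain for weak closure
of order `2N+1` of `S` with respect to `𝒢`. -/
def IsWitnessChain {G : Type*} [AddCommGroup G] {M : ℕ} (𝒢 : Set G) (S : Fin M → G)
    (N : ℕ) (Gc : ℕ → Set G) : Prop :=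
  (∀ n, n < N → Gc n ⊆ Gc (n + 1)) ∧
  (∀ n, n ≤ N → (Gc n).Finite) ∧
  Gc 0 = modeCombinations S 1 ∧
  (∀ n, 1 ≤ n → n ≤ N → checkSet Gc n ⊆ Gc n) ∧
  (∀ n, 1 ≤ n → n ≤ N → ∀ σ ∈ Gc n ∩ 𝒢, σ ∈ Gc (n - 1) ∨ σ ∉ checkSet Gc n)

/-- `S` is weakly closed of order `2N+1` with respect to `𝒢`. -/
def IsWeaklyClosedOfOrder {G : Type*} [AddCommGroup G] {M : ℕ} (𝒢 : Set G) (S : Fin M → G)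
    (N : ℕ) : Prop :=
  ∃ Gc : ℕ → Set G, IsWitnessChain 𝒢 S N Gc

theorem sub_add_mem_modeCombinations {G : Type*} [AddCommGroup G] {M : ℕ} {S : Fin M → G}
    {K : ℕ} {g : G} (hg : g ∈ modeCombinations S (2 * K + 1)) (a b : Fin M) :
    g - S a + S b ∈ modeCombinations S (2 * (K + 1) + 1) := by
  obtain ⟨f, rfl⟩ := hg
  change _ ∈ modeCombinations S (2 * K + 1 + 1 + 1)
  refine ⟨Fin.snoc (α := fun _ => Fin M) (Fin.snoc (α := fun _ => Fin M) f a) b, ?_⟩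
  rw [Fin.sum_univ_castSucc (n := 2 * K + 1 + 1), Fin.sum_univ_castSucc (n := 2 * K + 1)]
  simp [pow_succ, pow_mul, sub_eq_add_neg]

theorem mem_modeCombinations_pair {G : Type*} [AddCommGroup G] (σ₁ σ₂ : G) (K : ℕ) (j : ℤ)
    (hl : -(K : ℤ) ≤ j) (hu : j ≤ K + 1) :
    j • σ₁ + (1 - j) • σ₂ ∈ modeCombinations ![σ₁, σ₂] (2 * K + 1) := by
  induction K generalizing j with
  | zero =>
    obtain rfl | rfl : j = 0 ∨ j = 1 := by lia
    · exact ⟨fun _ => 1, by simp⟩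
    · exact ⟨fun _ => 0, by simp⟩
  | succ K ih =>
    obtain h | h | ⟨h₁, h₂⟩ : j = K + 2 ∨ j = -K - 1 ∨ (-(K : ℤ) ≤ j ∧ j ≤ K + 1) := by lia
    · convert sub_add_mem_modeCombinations (ih (j - 1) (by lia) (by lia)) 1 0 using 1
      simp only [Matrix.cons_val_zero, Matrix.cons_val_one]
      module
    · convert sub_add_mem_modeCombinations (ih (j + 1) (by lia) (by lia)) 0 1 using 1
      simp only [Matrix.cons_val_zero, Matrix.cons_val_one]
      module
    · simpa using sub_add_mem_modeCombinations (ih j h₁ h₂) 0 0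

theorem modeCombinations_pair_one {G : Type*} [AddCommGroup G] (σ₁ σ₂ : G) :
    modeCombinations ![σ₁, σ₂] 1 = {σ₁, σ₂} := by
  ext g
  constructor
  · rintro ⟨f, rfl⟩
    rcases Fin.exists_fin_two.mp ⟨f 0, rfl⟩ with h | h <;> simp [h]
  · rintro (rfl | rfl)
    · exact ⟨fun _ => 0, by simp⟩
    · exact ⟨fun _ => 1, by simp⟩

/-- weak closure of order `2N+1` (with `3N ≤ 2N*`) for a two-mode system whose
resonances of order `2N*+1` are contained in `{σ₁, σ₂, 3σ₁ - 2σ₂}`, witnessed by the chain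
`𝒢_{2n+1} = { j·σ₁ + (1-j)·σ₂ : -β_n ≤ j ≤ α_n }` with `α_n = ⌊3(n+1)/2⌋`, `β_n = ⌊3n/2⌋`. -/
theorem weaklyClosed_of_higher_order_resonance
    {G : Type*} [AddCommGroup G] (σ₁ σ₂ : G) (𝒢 : Set G)
    (hσ₁ : σ₁ ∈ 𝒢) (hσ₂ : σ₂ ∈ 𝒢)
    (Nstar : ℕ) (hNstar : 2 ≤ Nstar)
    (hres : 𝒢 ∩ modeCombinations ![σ₁, σ₂] (2 * Nstar + 1) ⊆
      {σ₁, σ₂, (3 : ℤ) • σ₁ - (2 : ℤ) • σ₂})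
    (N : ℕ) (hN : 1 ≤ N) (hNN : 3 * N ≤ 2 * Nstar)
    (hinj : ∀ j j' : ℤ,
      -((3 * N / 2 : ℕ) : ℤ) ≤ j → j ≤ ((3 * (N + 1) / 2 : ℕ) : ℤ) →
      -((3 * N / 2 : ℕ) : ℤ) ≤ j' → j' ≤ ((3 * (N + 1) / 2 : ℕ) : ℤ) →
      j • σ₁ + (1 - j) • σ₂ = j' • σ₁ + (1 - j') • σ₂ → j = j') :
    IsWeaklyClosedOfOrder 𝒢 ![σ₁, σ₂] N ∧
    IsWitnessChain 𝒢 ![σ₁, σ₂] N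
      (fun n => {g | ∃ j : ℤ, -((3 * n / 2 : ℕ) : ℤ) ≤ j ∧ j ≤ ((3 * (n + 1) / 2 : ℕ) : ℤ) ∧
        g = j • σ₁ + (1 - j) • σ₂}) := by
  refine (fun h => ⟨⟨_, h⟩, h⟩) ⟨?_, ?_, ?_, ?_, ?_⟩
  · rintro n - g ⟨j, h₁, h₂, rfl⟩
    exact ⟨j, by lia, by lia, rfl⟩
  · intro n _
    refine ((Set.finite_Icc (-((3 * n / 2 : ℕ) : ℤ)) ((3 * (n + 1) / 2 : ℕ) : ℤ)).image
      fun j => j • σ₁ + (1 - j) • σ₂).subset ?_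
    rintro g ⟨j, h₁, h₂, rfl⟩
    exact ⟨j, ⟨h₁, h₂⟩, rfl⟩
  · rw [modeCombinations_pair_one]
    ext g
    constructor
    · rintro ⟨j, h₁, h₂, rfl⟩
      obtain rfl | rfl : j = 0 ∨ j = 1 := by lia
      · simp
      · simp
    · rintro (rfl | rfl)
      · exact ⟨1, by simp⟩
      · exact ⟨0, by simp⟩
  · rintro n hn - g
      ⟨n₁, n₂, n₃, hsum, _, ⟨a, ha, ha', rfl⟩, _, ⟨b, hb, hb', rfl⟩, _, ⟨c, hc, hc', rfl⟩, rfl⟩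
    exact ⟨a - b + c, by lia, by lia, by module⟩
  · rintro n hn hnN σ ⟨⟨j, h₁, h₂, rfl⟩, hσ⟩
    rcases hres ⟨hσ, mem_modeCombinations_pair σ₁ σ₂ Nstar j (by lia) (by lia)⟩ with h | h | h
    · exact Or.inl ⟨1, by lia, by lia, by rw [h]; simp⟩
    · exact Or.inl ⟨0, by lia, by lia, by rw [h]; simp⟩
    · have h3 : j • σ₁ + (1 - j) • σ₂ = (3 : ℤ) • σ₁ + (1 - 3 : ℤ) • σ₂ := h.trans (by module)
      obtain rfl | hn2 : n = 1 ∨ 2 ≤ n := by lia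
      · right
        rintro ⟨n₁, n₂, n₃, hsum, _, ⟨a, ha, ha', rfl⟩, _, ⟨b, hb, hb', rfl⟩, _,
          ⟨c, hc, hc', rfl⟩, heq⟩
        obtain ⟨rfl, rfl, rfl⟩ : n₁ = 0 ∧ n₂ = 0 ∧ n₃ = 0 := by lia
        have := hinj 3 (a - b + c) (by lia) (by lia) (by lia) (by lia)
          (h3.symm.trans (heq.trans (by module)))
        lia
      · exact Or.inl ⟨3, by lia, by lia, h3⟩
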